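/- Let 𝔽 be a field and let the pencil L(λ) be a linearization of a polynomial matrix P(λ) ∈ 𝔽[λ]^{p×m}. Assume that rev₁L(λ) can be written as a linear polynomial system matrix [[Ã₁λ+Ã₀, B̃₁λ+B̃₀],[−(C̃₁λ+C̃₀), D̃₁λ+D̃₀]] ∈ 𝔽[λ]^{(n+p)×(n+m)} with state matrix Ã(λ) = Ã₁λ+Ã₀ such that Ã₀ is an invertible matrix, and assume that the transfer function matrix of rev₁L(λ) is equivalent at 0 to rev_ℓP(λ) for some ℓ ≥ deg P(λ). Then L(λ) is a strong linearization of P(λ). -/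

import Mathlib

open Polynomial Matrix

/-- The image of a polynomial matrix in the field of rational functions. -/
noncomputable def toRat {F : Type*} [Field F] {ι κ : Type*}
    (M : Matrix ι κ (Polynomial F)) : Matrix ι κ (RatFunc F) :=
  M.map (algebraMap (Polynomial F) (RatFunc F))

/-- Two rational matrices `G` and `H` are *equivalent at `0`* if `U G V = H` for some square
rational matrices `U`, `V` whose entries have no pole at `0` and whose evaluations at `0` are
invertible matrices. -/
def EquivAtZero {F : Type*} [Field F] {p m : ℕ}
    (G H : Matrix (Fin p) (Fin m) (RatFunc F)) : Prop :=
  ∃ (U : Matrix (Fin p) (Fin p) (RatFunc F)) (V : Matrix (Fin m) (Fin m) (RatFunc F)),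
    (∀ i j, (U i j).denom.eval 0 ≠ 0) ∧ (∀ i j, (V i j).denom.eval 0 ≠ 0) ∧
    IsUnit (U.map (RatFunc.eval (RingHom.id F) 0)).det ∧
    IsUnit (V.map (RatFunc.eval (RingHom.id F) 0)).det ∧
    U * G * V = H

section UnimodularEquivalence

variable {R : Type*} [CommRing R]
variable {ι κ ι' κ' : Type*} [Fintype ι] [DecidableEq ι] [Fintype κ] [DecidableEq κ]
  [Fintype ι'] [DecidableEq ι'] [Fintype κ'] [DecidableEq κ']

/-- Two matrices are unimodularly equivalent if `U * M * V = N` for some square matrices `U`, `V`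
with unit determinants. -/
def UnimodEquiv (M N : Matrix ι κ R) : Prop :=
  ∃ (U : Matrix ι ι R) (V : Matrix κ κ R), IsUnit U.det ∧ IsUnit V.det ∧ U * M * V = N

namespace UnimodEquiv

lemma refl (M : Matrix ι κ R) : UnimodEquiv M M := ⟨1, 1, by simp, by simp, by simp⟩

lemma trans {M N K : Matrix ι κ R} (h : UnimodEquiv M N) (h' : UnimodEquiv N K) :
    UnimodEquiv M K := by
  obtain ⟨U, V, hU, hV, rfl⟩ := h
  obtain ⟨U', V', hU', hV', rfl⟩ := h'
  exact ⟨U' * U, V * V', by simpa using hU'.mul hU, by simpa using hV.mul hV',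
    by simp only [Matrix.mul_assoc]⟩

lemma symm {M N : Matrix ι κ R} (h : UnimodEquiv M N) : UnimodEquiv N M := by
  obtain ⟨U, V, hU, hV, rfl⟩ := h
  refine ⟨U⁻¹, V⁻¹, by simpa using hU, by simpa using hV, ?_⟩
  rw [Matrix.mul_assoc, Matrix.mul_assoc, Matrix.mul_nonsing_inv _ hV, Matrix.mul_one,
    Matrix.nonsing_inv_mul_cancel_left _ _ hU]

lemma smul {M N : Matrix ι κ R} (h : UnimodEquiv M N) (a : R) :
    UnimodEquiv (a • M) (a • N) := by
  obtain ⟨U, V, hU, hV, rfl⟩ := h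
  exact ⟨U, V, hU, hV, by simp⟩

lemma submatrix {M N : Matrix ι κ R} (h : UnimodEquiv M N) (e : ι' ≃ ι) (f : κ' ≃ κ) :
    UnimodEquiv (M.submatrix e f) (N.submatrix e f) := by
  obtain ⟨U, V, hU, hV, rfl⟩ := h
  refine ⟨U.submatrix e e, V.submatrix f f, by simpa using hU, by simpa using hV, ?_⟩
  simp [Matrix.submatrix_mul_equiv]

lemma fromBlocks_diag {M N : Matrix ι κ R} {M' N' : Matrix ι' κ' R} (h : UnimodEquiv M N)
    (h' : UnimodEquiv M' N') :
    UnimodEquiv (fromBlocks M 0 0 M') (fromBlocks N 0 0 N') := by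
  obtain ⟨U, V, hU, hV, rfl⟩ := h
  obtain ⟨U', V', hU', hV', rfl⟩ := h'
  refine ⟨fromBlocks U 0 0 U', fromBlocks V 0 0 V', ?_, ?_, ?_⟩
  · simpa using ⟨hU, hU'⟩
  · simpa using ⟨hV, hV'⟩
  · simp [fromBlocks_multiply]

lemma submatrix_perm (M : Matrix ι κ R) (e : Equiv.Perm ι) (f : Equiv.Perm κ) :
    UnimodEquiv M (M.submatrix e f) := by
  refine ⟨(1 : Matrix ι ι R).submatrix e id, (1 : Matrix κ κ R).submatrix id f, ?_, ?_, ?_⟩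
  · rw [Matrix.det_permute]
    simpa using ((Equiv.Perm.sign e).isUnit.map (Int.castRingHom R))
  · rw [Matrix.det_permute']
    simpa using ((Equiv.Perm.sign f).isUnit.map (Int.castRingHom R))
  · ext i j
    simp [Matrix.mul_apply, Matrix.one_apply]

lemma transvection_mul (M : Matrix ι κ R) {i j : ι} (hij : i ≠ j) (c : R) :
    UnimodEquiv M (transvection i j c * M) :=
  ⟨transvection i j c, 1, by simp [det_transvection_of_ne _ _ hij], by simp, by simp⟩

lemma mul_transvection (M : Matrix ι κ R) {i j : κ} (hij : i ≠ j) (c : R) :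
    UnimodEquiv M (M * transvection i j c) :=
  ⟨1, transvection i j c, by simp, by simp [det_transvection_of_ne _ _ hij], by simp⟩

lemma fromBlocks_schur (B : Matrix ι' κ R) (C : Matrix ι ι' R) (D : Matrix ι κ R) :
    UnimodEquiv (fromBlocks 1 B C D) (fromBlocks 1 0 0 (D - C * B)) := by
  refine ⟨fromBlocks 1 0 (-C) 1, fromBlocks 1 (-B) 0 1, by simp, by simp, ?_⟩
  simp [fromBlocks_multiply, sub_eq_neg_add]

end UnimodEquiv

end UnimodularEquivalence

section SmithForm

/-- The rectangular matrix with `d 0, d 1, …` on the main diagonal. -/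
def rectDiagonal {R : Type*} [Zero R] (r c : ℕ) (d : ℕ → R) : Matrix (Fin r) (Fin c) R :=
  Matrix.of fun i j => if (i : ℕ) = j then d i else 0

/-- The equivalence splitting off the first index. -/
def unitSumFinEquiv (r : ℕ) : Unit ⊕ Fin r ≃ Fin (r + 1) where
  toFun := Sum.elim (fun _ => 0) Fin.succ
  invFun := Fin.cases (Sum.inl ()) Sum.inr
  left_inv := by rintro (_ | _) <;> rfl
  right_inv i := by refine Fin.cases ?_ (fun _ => ?_) i <;> rfl

lemma rectDiagonal_succ {R : Type*} [Zero R] (r c : ℕ) (d : ℕ → R) :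
    (rectDiagonal (r + 1) (c + 1) d).submatrix (unitSumFinEquiv r) (unitSumFinEquiv c) =
      fromBlocks (Matrix.of fun _ _ => d 0) 0 0 (rectDiagonal r c fun i => d (i + 1)) := by
  ext (i | i) (j | j) <;> simp [rectDiagonal, unitSumFinEquiv]

variable {R : Type*} [EuclideanDomain R]

/-- A nonzero matrix is equivalent to one having a nonzero entry that divides every entry. -/
lemma exists_unimodEquiv_dvd {ι κ : Type*} [Fintype ι] [DecidableEq ι] [Fintype κ]
    [DecidableEq κ] (M : Matrix ι κ R) (hM : M ≠ 0) :
    ∃ (N : Matrix ι κ R) (i₀ : ι) (j₀ : κ), UnimodEquiv M N ∧ N i₀ j₀ ≠ 0 ∧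
      ∀ i j, N i₀ j₀ ∣ N i j := by
  classical
  let S : Set R := {a | a ≠ 0 ∧ ∃ N i j, UnimodEquiv M N ∧ N i j = a}
  have hS : S.Nonempty := by
    obtain ⟨i, j, hij⟩ : ∃ i j, M i j ≠ 0 := by
      by_contra! h
      exact hM (by ext i j; exact h i j)
    exact ⟨M i j, hij, M, i, j, .refl M, rfl⟩
  obtain ⟨a, ⟨ha0, N, i₀, j₀, hN, rfl⟩, hmin⟩ :
      ∃ a ∈ S, ∀ b ∈ S, ¬ EuclideanDomain.r b a :=
    EuclideanDomain.r_wellFounded.has_min S hS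
  have key : ∀ b N' i j, UnimodEquiv M N' → N' i j = b % N i₀ j₀ → N i₀ j₀ ∣ b := by
    intro b N' i j hN' hb
    by_contra hdvd
    exact hmin (b % N i₀ j₀)
      ⟨fun h => hdvd ((EuclideanDomain.mod_eq_zero).1 h), N', i, j, hN', hb⟩
      (EuclideanDomain.mod_lt _ ha0)
  have hmod : ∀ b c : R, b + (-(b / c)) * c = b % c := fun b c => by
    rw [EuclideanDomain.mod_eq_sub_mul_div]; ring
  have row : ∀ N', UnimodEquiv M N' → ∀ i j, N' i j = N i₀ j₀ → ∀ j', N i₀ j₀ ∣ N' i j' := by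
    intro N' hN' i j hij j'
    rcases eq_or_ne j j' with rfl | hj
    · rw [hij]
    · refine key _ _ i j' (hN'.trans (.mul_transvection N' hj (-(N' i j' / N i₀ j₀)))) ?_
      rw [mul_transvection_apply_same, hij, hmod]
  have col : ∀ i', N i₀ j₀ ∣ N i' j₀ := by
    intro i'
    rcases eq_or_ne i' i₀ with rfl | hi
    · rfl
    · refine key _ _ i' j₀ (hN.trans (.transvection_mul N hi (-(N i' j₀ / N i₀ j₀)))) ?_
      rw [transvection_mul_apply_same, hmod]
  refine ⟨N, i₀, j₀, hN, ha0, fun i j => ?_⟩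
  rcases eq_or_ne i i₀ with rfl | hi
  · exact row N hN _ _ rfl j
  · obtain ⟨q, hq⟩ := col i
    have h := row _ (hN.trans (.transvection_mul N hi (1 - q))) i j₀
      (by rw [transvection_mul_apply_same, hq]; ring) j
    rw [transvection_mul_apply_same] at h
    exact (dvd_add_left ((row N hN i₀ j₀ rfl j).mul_left _)).1 h

/-- Existence of the Smith normal form over a Euclidean domain. -/
theorem exists_unimodEquiv_rectDiagonal (r c : ℕ) (M : Matrix (Fin r) (Fin c) R) :
    ∃ d : ℕ → R, (∀ i, d i ∣ d (i + 1)) ∧ UnimodEquiv M (rectDiagonal r c d) := by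
  induction r generalizing c with
  | zero => exact ⟨0, by simp, by
      convert UnimodEquiv.refl M; ext i; exact i.elim0⟩
  | succ r ih =>
    by_cases hM : M = 0
    · exact ⟨0, by simp, by convert UnimodEquiv.refl M; subst hM; ext; simp [rectDiagonal]⟩
    cases c with
    | zero => exact absurd (by ext i j; exact j.elim0) hM
    | succ c =>
      obtain ⟨N, i₀, j₀, hN, ha, hdvd⟩ := exists_unimodEquiv_dvd M hM
      set a := N i₀ j₀
      choose E hE using hdvd
      let e := (unitSumFinEquiv r).trans (Equiv.swap 0 i₀)
      let f := (unitSumFinEquiv c).trans (Equiv.swap 0 j₀)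
      let E' : Matrix (Unit ⊕ Fin r) (Unit ⊕ Fin c) R := (Matrix.of E).submatrix e f
      have hE1 : E'.toBlocks₁₁ = 1 := by
        ext i j
        have : E i₀ j₀ = 1 := mul_left_cancel₀ ha (by rw [← hE, mul_one])
        simp [E', toBlocks₁₁, e, f, unitSumFinEquiv, this]
      obtain ⟨d, hd, hdE⟩ := ih c (E'.toBlocks₂₂ - E'.toBlocks₂₁ * E'.toBlocks₁₂)
      refine ⟨fun k => Nat.casesOn k a fun k => a * d k, ?_, ?_⟩
      · rintro (_ | i)
        · exact dvd_mul_right _ _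
        · exact mul_dvd_mul_left _ (hd i)
      have h1 : UnimodEquiv E' (fromBlocks 1 0 0 (rectDiagonal r c d)) := by
        rw [← fromBlocks_toBlocks E', hE1]
        exact (UnimodEquiv.fromBlocks_schur _ _ _).trans (.fromBlocks_diag (.refl _) hdE)
      have h2 := (h1.smul a).submatrix (unitSumFinEquiv r).symm (unitSumFinEquiv c).symm
      refine (hN.trans (.submatrix_perm N (Equiv.swap 0 i₀) (Equiv.swap 0 j₀))).trans ?_
      convert h2 using 1
      · ext i j
        simp [E', e, f, hE]
      · rw [← (rectDiagonal (r + 1) (c + 1) _).submatrix_id_id,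
          ← (unitSumFinEquiv r).self_comp_symm, ← (unitSumFinEquiv c).self_comp_symm,
          ← submatrix_submatrix, rectDiagonal_succ, fromBlocks_smul]
        congr 1
        congr 1
        · ext; simp
        · simp
        · simp
        · ext; simp [rectDiagonal]

end SmithForm

section Minors

variable {R : Type*} [CommRing R]

lemma dvd_minor_mul {ι κ τ : Type*} [Fintype κ] {k : ℕ} {e : R}
    {M : Matrix κ τ R} (h : ∀ (f : Fin k → κ) (g : Fin k → τ), e ∣ (M.submatrix f g).det)
    (U : Matrix ι κ R) (f : Fin k → ι) (g : Fin k → τ) :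
    e ∣ ((U * M).submatrix f g).det := by
  classical
  have : (U * M).submatrix f g = fun i => ∑ j, U (f i) j • fun l => M j (g l) := by
    ext i l
    simp [Matrix.mul_apply]
  change e ∣ (detRowAlternating (R := R)).toMultilinearMap _
  rw [this, MultilinearMap.map_sum]
  refine Finset.dvd_sum fun s _ => ?_
  rw [MultilinearMap.map_smul_univ]
  exact (h s g).mul_left _

lemma dvd_minor_mul_right {ι κ τ : Type*} [Fintype κ] {k : ℕ} {e : R}
    {M : Matrix τ κ R} (h : ∀ (f : Fin k → τ) (g : Fin k → κ), e ∣ (M.submatrix f g).det)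
    (V : Matrix κ ι R) (f : Fin k → τ) (g : Fin k → ι) :
    e ∣ ((M * V).submatrix f g).det := by
  rw [← det_transpose, transpose_submatrix, transpose_mul]
  refine dvd_minor_mul (fun f g => ?_) _ _ _
  rw [← transpose_submatrix, det_transpose]
  exact h g f

lemma prod_range_dvd_prod {d : ℕ → R} (hd : ∀ i, d i ∣ d (i + 1)) (s : Finset ℕ) :
    ∏ i ∈ Finset.range s.card, d i ∣ ∏ i ∈ s, d i := by
  induction s using Finset.induction_on_max with
  | empty => simp
  | insert a s hs ih =>
    have ha : a ∉ s := fun h => (hs a h).false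
    rw [Finset.card_insert_of_notMem ha, Finset.prod_range_succ, Finset.prod_insert ha, mul_comm]
    refine mul_dvd_mul ?_ ih
    have hle : s.card ≤ a := by
      simpa using Finset.card_le_card (fun x hx => Finset.mem_range.2 (hs x hx))
    exact Nat.le_induction dvd_rfl (fun n _ h => h.trans (hd n)) a hle

lemma prod_range_dvd_minor_rectDiagonal {r c k : ℕ} {d : ℕ → R} (hd : ∀ i, d i ∣ d (i + 1))
    (f : Fin k → Fin r) (g : Fin k → Fin c) :
    ∏ i ∈ Finset.range k, d i ∣ ((rectDiagonal r c d).submatrix f g).det := by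
  by_cases hg : Function.Injective g
  · rw [det_apply]
    refine Finset.dvd_sum fun σ _ => ?_
    rw [Units.smul_def, zsmul_eq_mul]
    refine Dvd.dvd.mul_left ?_ _
    by_cases h : ∀ i, (f (σ i) : ℕ) = g i
    · have hinj : Function.Injective fun i => (g i : ℕ) := Fin.val_injective.comp hg
      have := prod_range_dvd_prod hd (Finset.univ.map ⟨_, hinj⟩)
      simpa [rectDiagonal, h] using this
    · push Not at h
      obtain ⟨i, hi⟩ := h
      rw [Finset.prod_eq_zero (Finset.mem_univ i) (by simp [rectDiagonal, hi])]
      exact dvd_zero _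
  · simp only [Function.Injective, not_forall] at hg
    obtain ⟨i, j, hij, hne⟩ := hg
    rw [det_zero_of_column_eq hne fun l => by simp [hij]]
    exact dvd_zero _

lemma prod_range_dvd_of_mul_eq_smul {r c k : ℕ} {d d' : ℕ → R} (hd : ∀ i, d i ∣ d (i + 1))
    (hr : k ≤ r) (hc : k ≤ c) {U : Matrix (Fin r) (Fin r) R} {V : Matrix (Fin c) (Fin c) R}
    {w : R} (h : U * rectDiagonal r c d * V = w • rectDiagonal r c d') :
    ∏ i ∈ Finset.range k, d i ∣ w ^ k * ∏ i ∈ Finset.range k, d' i := by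
  have hdvd := dvd_minor_mul_right (dvd_minor_mul (k := k)
    (prod_range_dvd_minor_rectDiagonal hd) U) V (Fin.castLE hr) (Fin.castLE hc)
  have hdiag : (rectDiagonal r c d').submatrix (Fin.castLE hr) (Fin.castLE hc) =
      diagonal fun i : Fin k => d' i := by
    ext i j
    simp [rectDiagonal, diagonal_apply, Fin.ext_iff]
  rw [h, submatrix_smul, Pi.smul_apply, Pi.smul_apply, hdiag, det_smul, det_diagonal,
    Fintype.card_fin, Fin.prod_univ_eq_prod_range] at hdvd
  exact hdvd

/-- `M` can be multiplied on both sides into the scalar multiple `w • N`. -/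
def TransformsTo {ι κ : Type*} [Fintype ι] [Fintype κ] (w : R) (M N : Matrix ι κ R) : Prop :=
  ∃ (U : Matrix ι ι R) (V : Matrix κ κ R), U * M * V = w • N

lemma TransformsTo.congr {ι κ : Type*} [Fintype ι] [Fintype κ] [DecidableEq ι] [DecidableEq κ]
    {w : R} {M N M' N' : Matrix ι κ R}
    (h : TransformsTo w M N) (hM : UnimodEquiv M' M) (hN : UnimodEquiv N N') :
    TransformsTo w M' N' := by
  obtain ⟨U, V, h⟩ := h
  obtain ⟨U₁, V₁, -, -, rfl⟩ := hM
  obtain ⟨U₂, V₂, -, -, rfl⟩ := hN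
  refine ⟨U₂ * U * U₁, V₁ * V * V₂, ?_⟩
  calc _ = U₂ * (U * (U₁ * M' * V₁) * V) * V₂ := by simp only [Matrix.mul_assoc]
    _ = _ := by rw [h]; simp

lemma TransformsTo.submatrix {ι κ ι' κ' : Type*} [Fintype ι] [Fintype κ] [Fintype ι'] [Fintype κ']
    {w : R} {M N : Matrix ι κ R} (h : TransformsTo w M N) (e : ι' ≃ ι) (f : κ' ≃ κ) :
    TransformsTo w (M.submatrix e f) (N.submatrix e f) := by
  obtain ⟨U, V, h⟩ := h
  refine ⟨U.submatrix e e, V.submatrix f f, ?_⟩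
  rw [submatrix_mul_equiv, submatrix_mul_equiv, h]
  rfl

end Minors

section LocalGlobal

lemma prod_range_dvd_of_transformsTo {R : Type*} [CommRing R] {r c k : ℕ} {d d' : ℕ → R}
    (hd : ∀ i, d i ∣ d (i + 1)) (hr : k ≤ r) (hc : k ≤ c) {w₁ w₂ : R} (hw : IsCoprime w₁ w₂)
    (h₁ : TransformsTo w₁ (rectDiagonal r c d) (rectDiagonal r c d'))
    (h₂ : TransformsTo w₂ (rectDiagonal r c d) (rectDiagonal r c d')) :
    ∏ i ∈ Finset.range k, d i ∣ ∏ i ∈ Finset.range k, d' i := by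
  obtain ⟨U₁, V₁, h₁⟩ := h₁
  obtain ⟨U₂, V₂, h₂⟩ := h₂
  obtain ⟨a, b, hab⟩ := hw.pow (m := k) (n := k)
  rw [← one_mul (∏ i ∈ Finset.range k, d' i), ← hab, add_mul, mul_assoc, mul_assoc]
  exact dvd_add ((prod_range_dvd_of_mul_eq_smul hd hr hc h₁).mul_left _)
    ((prod_range_dvd_of_mul_eq_smul hd hr hc h₂).mul_left _)

lemma associated_of_prod_range {R : Type*} [CommRing R] [IsDomain R] {d d' : ℕ → R}
    (hd : ∀ i, d i ∣ d (i + 1)) (hd' : ∀ i, d' i ∣ d' (i + 1)) {k : ℕ}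
    (h : Associated (∏ i ∈ Finset.range k, d i) (∏ i ∈ Finset.range k, d' i))
    (h' : Associated (∏ i ∈ Finset.range (k + 1), d i) (∏ i ∈ Finset.range (k + 1), d' i)) :
    Associated (d k) (d' k) := by
  have zero : ∀ {d : ℕ → R}, (∀ i, d i ∣ d (i + 1)) →
      ∏ i ∈ Finset.range k, d i = 0 → d k = 0 := by
    intro d hd h0
    obtain ⟨i, hi, hi0⟩ := Finset.prod_eq_zero_iff.1 h0
    exact zero_dvd_iff.1 (hi0 ▸ Nat.le_induction dvd_rfl (fun n _ h => h.trans (hd n)) k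
      (Finset.mem_range.1 hi).le)
  by_cases h0 : ∏ i ∈ Finset.range k, d i = 0
  · rw [zero hd h0, zero hd' (h.eq_zero_iff.1 h0)]
  · rw [Finset.prod_range_succ, Finset.prod_range_succ] at h'
    exact h'.of_mul_left h h0

lemma unimodEquiv_rectDiagonal_of_associated {R : Type*} [CommRing R] {r c : ℕ} {d d' : ℕ → R}
    (h : ∀ k, k < r → k < c → Associated (d k) (d' k)) :
    UnimodEquiv (rectDiagonal r c d) (rectDiagonal r c d') := by
  have h' : ∀ k, ∃ u : Rˣ, k < r → k < c → d k * u = d' k := fun k => by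
    by_cases hk : k < r ∧ k < c
    · obtain ⟨u, hu⟩ := h k hk.1 hk.2
      exact ⟨u, fun _ _ => hu⟩
    · exact ⟨1, fun hr hc => absurd ⟨hr, hc⟩ hk⟩
  choose u hu using h'
  refine ⟨diagonal fun i => (u i : R), 1, ?_, by simp, ?_⟩
  · rw [det_diagonal, ← Units.coe_prod]
    exact Units.isUnit _
  · ext i j
    rw [Matrix.mul_one, diagonal_mul]
    by_cases hij : (i : ℕ) = j
    · simp [rectDiagonal, hij, ← hu j (hij ▸ i.2) j.2, mul_comm]
    · simp [rectDiagonal, hij]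

/-- Two matrices over a Euclidean domain that transform into each other up to scalars, in two ways
with coprime scalars, are unimodularly equivalent. -/
theorem unimodEquiv_of_transformsTo {R : Type*} [EuclideanDomain R] {ι κ : Type*} [Fintype ι]
    [DecidableEq ι] [Fintype κ] [DecidableEq κ] {M N : Matrix ι κ R} {w₁ w₂ w₁' w₂' : R}
    (hw : IsCoprime w₁ w₂) (h₁ : TransformsTo w₁ M N) (h₂ : TransformsTo w₂ M N)
    (hw' : IsCoprime w₁' w₂') (h₁' : TransformsTo w₁' N M) (h₂' : TransformsTo w₂' N M) :
    UnimodEquiv M N := by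
  let e := Fintype.equivFin ι
  let f := Fintype.equivFin κ
  obtain ⟨d, hd, hM⟩ := exists_unimodEquiv_rectDiagonal _ _ (M.submatrix e.symm f.symm)
  obtain ⟨d', hd', hN⟩ := exists_unimodEquiv_rectDiagonal _ _ (N.submatrix e.symm f.symm)
  have tr : ∀ {w}, TransformsTo w M N →
      TransformsTo w (rectDiagonal _ _ d) (rectDiagonal _ _ d') :=
    fun h => (h.submatrix e.symm f.symm).congr hM.symm hN
  have tr' : ∀ {w}, TransformsTo w N M →
      TransformsTo w (rectDiagonal _ _ d') (rectDiagonal _ _ d) :=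
    fun h => (h.submatrix e.symm f.symm).congr hN.symm hM
  have hprod : ∀ k, k ≤ Fintype.card ι → k ≤ Fintype.card κ →
      Associated (∏ i ∈ Finset.range k, d i) (∏ i ∈ Finset.range k, d' i) := fun k hr hc =>
    associated_of_dvd_dvd (prod_range_dvd_of_transformsTo hd hr hc hw (tr h₁) (tr h₂))
      (prod_range_dvd_of_transformsTo hd' hr hc hw' (tr' h₁') (tr' h₂'))
  have hdd : UnimodEquiv (rectDiagonal (Fintype.card ι) (Fintype.card κ) d)
      (rectDiagonal _ _ d') := unimodEquiv_rectDiagonal_of_associated fun k hr hc =>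
    associated_of_prod_range hd hd' (hprod k hr.le hc.le) (hprod (k + 1) hr hc)
  simpa using ((hM.trans hdd).trans hN.symm).submatrix e f

end LocalGlobal

section AtInfinity

variable {F : Type*} [Field F]

lemma reflect_eq_X_pow_mul {f : F[X]} {l T : ℕ} (hf : f.natDegree ≤ l) (hT : l ≤ T) :
    reflect T f = X ^ (T - l) * reflect l f := by
  have h := reflect_mul f 1 hf (natDegree_one.trans_le (Nat.zero_le (T - l)))
  rwa [Nat.add_sub_cancel' hT, mul_one, reflect_one, mul_comm] at h

lemma map_reflect_eq_smul {ι κ : Type*} {A : Matrix ι κ F[X]} {l T : ℕ}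
    (hA : ∀ i j, (A i j).natDegree ≤ l) (hT : l ≤ T) :
    A.map (reflect T) = (X : F[X]) ^ (T - l) • A.map (reflect l) := by
  ext1 i j
  simp [reflect_eq_X_pow_mul (hA i j) hT]

lemma map_reflect_mul {ι κ τ : Type*} [Fintype κ] {A : Matrix ι κ F[X]} {B : Matrix κ τ F[X]}
    {K K' : ℕ} (hA : ∀ i j, (A i j).natDegree ≤ K) (hB : ∀ i j, (B i j).natDegree ≤ K') :
    (A * B).map (reflect (K + K')) = A.map (reflect K) * B.map (reflect K') := by
  ext1 i j
  let φ : F[X] →+ F[X] := ⟨⟨reflect (K + K'), reflect_zero⟩, fun f g => reflect_add f g _⟩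
  simp only [map_apply, mul_apply]
  exact (map_sum φ _ _).trans (Finset.sum_congr rfl fun k _ => reflect_mul _ _ (hA i k) (hB k j))

lemma natDegree_mul_le_of_entries {ι κ τ : Type*} [Fintype κ] {A : Matrix ι κ F[X]}
    {B : Matrix κ τ F[X]} {K K' : ℕ} (hA : ∀ i j, (A i j).natDegree ≤ K)
    (hB : ∀ i j, (B i j).natDegree ≤ K') (i : ι) (j : τ) :
    ((A * B) i j).natDegree ≤ K + K' :=
  natDegree_sum_le_of_forall_le _ _ fun k _ => natDegree_mul_le_of_le (hA i k) (hB k j)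

lemma exists_natDegree_entry_le {ι κ : Type*} [Fintype ι] [Fintype κ] (A : Matrix ι κ F[X])
    (l : ℕ) : ∃ K, l ≤ K ∧ ∀ i j, (A i j).natDegree ≤ K := by
  refine ⟨l + ∑ i, ∑ j, (A i j).natDegree, Nat.le_add_right _ _, fun i j => ?_⟩
  calc (A i j).natDegree ≤ ∑ j, (A i j).natDegree :=
        Finset.single_le_sum (f := fun j => (A i j).natDegree) (fun _ _ => Nat.zero_le _)
          (Finset.mem_univ j)
    _ ≤ ∑ i, ∑ j, (A i j).natDegree :=
        Finset.single_le_sum (f := fun i => ∑ j, (A i j).natDegree) (fun _ _ => Nat.zero_le _)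
          (Finset.mem_univ i)
    _ ≤ _ := Nat.le_add_left _ _

lemma exists_map_reflect_mul_mul {ι κ : Type*} [Fintype ι] [Fintype κ] (U : Matrix ι ι F[X])
    {M : Matrix ι κ F[X]} (V : Matrix κ κ F[X]) {k : ℕ} (hM : ∀ i j, (M i j).natDegree ≤ k)
    (l : ℕ) : ∃ T, l ≤ T ∧ ∃ (U' : Matrix ι ι F[X]) (V' : Matrix κ κ F[X]),
      (U * M * V).map (reflect T) = U' * M.map (reflect k) * V' := by
  obtain ⟨K₁, hl, hU⟩ := exists_natDegree_entry_le U l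
  obtain ⟨K₂, -, hV⟩ := exists_natDegree_entry_le V 0
  refine ⟨K₁ + k + K₂, by lia, U.map (reflect K₁), V.map (reflect K₂), ?_⟩
  rw [map_reflect_mul (natDegree_mul_le_of_entries hU hM) hV, map_reflect_mul hU hM]

lemma map_reflect_fromBlocks_one {ι κ τ : Type*} [Fintype ι] [DecidableEq ι]
    (P : Matrix κ τ F[X]) (T : ℕ) :
    (fromBlocks (1 : Matrix ι ι F[X]) 0 0 P).map (reflect T) =
      fromBlocks ((X : F[X]) ^ T • (1 : Matrix ι ι F[X])) 0 0 (P.map (reflect T)) := by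
  rw [fromBlocks_map]
  congr 1
  ext1 i j
  by_cases h : i = j <;> simp [h, one_apply, reflect_one]

variable {ι κ τ : Type*} [Fintype ι] [DecidableEq ι] [Fintype κ] [DecidableEq κ]
  [Fintype τ] [DecidableEq τ] {L : Matrix (ι ⊕ κ) (ι ⊕ τ) F[X]} {P : Matrix κ τ F[X]}

lemma transformsTo_map_reflect {k l : ℕ} (hL : ∀ i j, (L i j).natDegree ≤ k)
    (hP : ∀ i j, (P i j).natDegree ≤ l) (h : UnimodEquiv L (fromBlocks 1 0 0 P)) :
    ∃ T, TransformsTo ((X : F[X]) ^ T) (L.map (reflect k))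
      (fromBlocks 1 0 0 (P.map (reflect l))) := by
  obtain ⟨U, V, -, -, h⟩ := h
  obtain ⟨T, hT, U', V', h'⟩ := exists_map_reflect_mul_mul U V hL l
  refine ⟨T, fromBlocks 1 0 0 ((X : F[X]) ^ l • 1) * U', V', ?_⟩
  rw [Matrix.mul_assoc _ U', Matrix.mul_assoc, ← h', h, map_reflect_fromBlocks_one,
    map_reflect_eq_smul hP hT, fromBlocks_multiply, fromBlocks_smul]
  simp [smul_smul, ← pow_add, Nat.sub_add_cancel hT]

lemma transformsTo_map_reflect_symm {k l : ℕ} (hL : ∀ i j, (L i j).natDegree ≤ k)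
    (hP : ∀ i j, (P i j).natDegree ≤ l) (h : UnimodEquiv L (fromBlocks 1 0 0 P)) :
    ∃ T, TransformsTo ((X : F[X]) ^ T) (fromBlocks 1 0 0 (P.map (reflect l)))
      (L.map (reflect k)) := by
  obtain ⟨U, V, -, -, h⟩ := h.symm
  have hP' : ∀ i j, ((fromBlocks 1 0 0 P : Matrix (ι ⊕ κ) (ι ⊕ τ) F[X]) i j).natDegree ≤ l := by
    rintro (i | i) (j | j)
    · by_cases hij : i = j <;> simp [hij, one_apply]
    · simp
    · simp
    · simpa using hP i j
  obtain ⟨T, hT, U', V', h'⟩ := exists_map_reflect_mul_mul U V hP' k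
  refine ⟨T - k, U' * fromBlocks ((X : F[X]) ^ l • 1) 0 0 1, V', ?_⟩
  rw [← map_reflect_eq_smul hL hT, ← h, h', map_reflect_fromBlocks_one, Matrix.mul_assoc U',
    fromBlocks_multiply]
  simp

end AtInfinity

section AtZero

variable {F : Type*} [Field F]

lemma TransformsTo.symm_of_eval_det_ne_zero {ι κ : Type*} [Fintype ι] [DecidableEq ι]
    [Fintype κ] [DecidableEq κ] {M N : Matrix ι κ F[X]} {U : Matrix ι ι F[X]}
    {V : Matrix κ κ F[X]} {w : F[X]} (h : U * M * V = w • N) (hU : U.det.eval 0 ≠ 0)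
    (hV : V.det.eval 0 ≠ 0) : ∃ w' : F[X], w'.eval 0 ≠ 0 ∧ TransformsTo w' N M := by
  refine ⟨U.det * V.det, by simpa using ⟨hU, hV⟩, w • U.adjugate, V.adjugate, ?_⟩
  calc w • U.adjugate * N * V.adjugate = U.adjugate * (w • N) * V.adjugate := by simp
    _ = (U.adjugate * U) * M * (V * V.adjugate) := by
        rw [← h]; simp only [Matrix.mul_assoc]
    _ = _ := by simp [adjugate_mul, mul_adjugate, smul_smul, mul_comm]

/-- Clearing the denominators of a rational matrix without poles at `0`. -/
lemma exists_toRat_eq_smul {ι : Type*} [Fintype ι] [DecidableEq ι]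
    (U : Matrix ι ι (RatFunc F)) (hU : ∀ i j, (U i j).denom.eval 0 ≠ 0)
    (hdet : IsUnit (U.map (RatFunc.eval (RingHom.id F) 0)).det) :
    ∃ (u : F[X]) (U' : Matrix ι ι F[X]), u.eval 0 ≠ 0 ∧ U'.det.eval 0 ≠ 0 ∧
      toRat U' = algebraMap F[X] (RatFunc F) u • U := by
  set u : F[X] := ∏ i, ∏ j, (U i j).denom with hu
  have hu0 : u.eval 0 ≠ 0 := by
    simp only [hu, eval_prod]
    exact Finset.prod_ne_zero_iff.2 fun i _ => Finset.prod_ne_zero_iff.2 fun j _ => hU i j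
  have hdvd : ∀ i j, (U i j).denom ∣ u := fun i j =>
    (Finset.dvd_prod_of_mem (fun j => (U i j).denom) (Finset.mem_univ j)).trans
      (Finset.dvd_prod_of_mem (fun i => ∏ j, (U i j).denom) (Finset.mem_univ i))
  choose q hq using hdvd
  refine ⟨u, Matrix.of fun i j => (U i j).num * q i j, hu0, ?_, ?_⟩
  · have hmap : (Matrix.of fun i j => (U i j).num * q i j).map (evalRingHom 0) =
        u.eval 0 • U.map (RatFunc.eval (RingHom.id F) 0) := by
      ext1 i j
      have h0 := hU i j
      simp only [map_apply, of_apply, coe_evalRingHom, eval_mul, Matrix.smul_apply,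
        smul_eq_mul, RatFunc.eval, eval₂_id]
      rw [hq i j, eval_mul]
      field_simp
    rw [← coe_evalRingHom, RingHom.map_det, RingHom.mapMatrix_apply, hmap, det_smul]
    exact mul_ne_zero (pow_ne_zero _ hu0) hdet.ne_zero
  · ext1 i j
    have h0 : algebraMap F[X] (RatFunc F) (U i j).denom ≠ 0 :=
      RatFunc.algebraMap_ne_zero (RatFunc.denom_ne_zero _)
    simp only [toRat, map_apply, of_apply, map_mul, Matrix.smul_apply, smul_eq_mul]
    rw [hq i j, map_mul, (div_eq_iff h0).1 (RatFunc.num_div_denom (U i j))]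
    ring

lemma toRat_mul {ι κ τ : Type*} [Fintype κ] (A : Matrix ι κ F[X]) (B : Matrix κ τ F[X]) :
    toRat (A * B) = toRat A * toRat B :=
  Matrix.map_mul

lemma toRat_injective {ι κ : Type*} :
    Function.Injective (toRat : Matrix ι κ F[X] → Matrix ι κ (RatFunc F)) :=
  Matrix.map_injective (RatFunc.algebraMap_injective F)

variable {n p m : ℕ} {A : Matrix (Fin n) (Fin n) F[X]} {B : Matrix (Fin n) (Fin m) F[X]}
    {C : Matrix (Fin p) (Fin n) F[X]} {D Q : Matrix (Fin p) (Fin m) F[X]}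

lemma toRat_schur (hA : A.det ≠ 0) :
    toRat (A.det • D + C * A.adjugate * B) =
      algebraMap F[X] (RatFunc F) A.det • (toRat D + toRat C * (toRat A)⁻¹ * toRat B) := by
  have hdet : (toRat A).det = algebraMap F[X] (RatFunc F) A.det := (RingHom.map_det _ _).symm
  have hadj : toRat A.adjugate = (toRat A).adjugate := RingHom.map_adjugate _ _
  have hne : algebraMap F[X] (RatFunc F) A.det ≠ 0 := RatFunc.algebraMap_ne_zero hA
  have hinv : toRat A.adjugate = algebraMap F[X] (RatFunc F) A.det • (toRat A)⁻¹ := by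
    rw [Matrix.inv_def, hdet, hadj, smul_smul, Ring.mul_inverse_cancel _ hne.isUnit, one_smul]
  have hadd : toRat (A.det • D + C * A.adjugate * B) =
      toRat (A.det • D) + toRat (C * A.adjugate * B) := by
    exact Matrix.map_add _ (map_add _) _ _
  have hsmul : toRat (A.det • D) = algebraMap F[X] (RatFunc F) A.det • toRat D := by
    ext1; simp [toRat]
  rw [hadd, hsmul, toRat_mul, toRat_mul, hinv, smul_add]
  simp

/-- A system matrix whose state matrix is invertible at `0` transforms into `diag(I, Q)`, up to a
scalar not vanishing at `0`, when its transfer function is equivalent at `0` to `Q`. -/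
lemma exists_mul_systemMatrix_mul (hA : A.det.eval 0 ≠ 0)
    (h : EquivAtZero (toRat D + toRat C * (toRat A)⁻¹ * toRat B) (toRat Q)) :
    ∃ (U : Matrix (Fin n ⊕ Fin p) (Fin n ⊕ Fin p) F[X])
      (V : Matrix (Fin n ⊕ Fin m) (Fin n ⊕ Fin m) F[X]) (w : F[X]),
      U.det.eval 0 ≠ 0 ∧ V.det.eval 0 ≠ 0 ∧ w.eval 0 ≠ 0 ∧
        U * fromBlocks A B (-C) D * V = w • fromBlocks 1 0 0 Q := by
  obtain ⟨U, V, hU, hV, hU0, hV0, hG⟩ := h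
  obtain ⟨u, U', hu, hU', hUU⟩ := exists_toRat_eq_smul U hU hU0
  obtain ⟨v, V', hv, hV', hVV⟩ := exists_toRat_eq_smul V hV hV0
  have hA' : A.det ≠ 0 := fun h => hA (by simp [h])
  set G := A.det • D + C * A.adjugate * B with hGdef
  have hpoly : U' * G * V' = (u * v * A.det) • Q := by
    apply toRat_injective
    have hQ : toRat ((u * v * A.det) • Q) =
        algebraMap F[X] (RatFunc F) (u * v * A.det) • toRat Q := by
      ext1; simp [toRat]
    rw [toRat_mul, toRat_mul, hUU, hVV, toRat_schur hA', hQ, ← hG]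
    simp only [Matrix.smul_mul, Matrix.mul_smul, smul_smul, map_mul]
    congr 1
    ring
  have hadj : A.adjugate.det.eval 0 ≠ 0 := by
    rw [det_adjugate, eval_pow]
    exact pow_ne_zero _ hA
  obtain ⟨E, hE⟩ : ∃ E : Matrix (Fin n ⊕ Fin p) (Fin n ⊕ Fin p) F[X],
    E = fromBlocks 1 0 (C * A.adjugate) (A.det • 1) := ⟨_, rfl⟩
  obtain ⟨E', hE'⟩ : ∃ E' : Matrix (Fin n ⊕ Fin m) (Fin n ⊕ Fin m) F[X],
    E' = fromBlocks A.adjugate (-(A.adjugate * B)) 0 (A.det • 1) := ⟨_, rfl⟩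
  refine ⟨fromBlocks ((u * v * A.det) • 1) 0 0 U' * E, E' * fromBlocks 1 0 0 V',
    A.det * (u * v * A.det), ?_, ?_, ?_, ?_⟩
  · simp [hE, hA, hu, hv, hU']
  · simp [hE', hA, hadj, hV']
  · simp [hA, hu, hv]
  · have h1 : E * fromBlocks A B (-C) D = fromBlocks A B 0 G := by
      simp [hE, fromBlocks_multiply, hGdef, Matrix.mul_assoc, adjugate_mul, add_comm]
    have h2 : fromBlocks A B 0 G * E' = A.det • fromBlocks 1 0 0 G := by
      simp [hE', fromBlocks_multiply, fromBlocks_smul, mul_adjugate, ← Matrix.mul_assoc]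
    calc _ = (fromBlocks ((u * v * A.det) • 1) 0 0 U' : Matrix (Fin n ⊕ Fin p) (Fin n ⊕ Fin p) _) *
            (E * (fromBlocks A B (-C) D : Matrix (Fin n ⊕ Fin p) (Fin n ⊕ Fin m) _) * E') *
          (fromBlocks 1 0 0 V' : Matrix (Fin n ⊕ Fin m) (Fin n ⊕ Fin m) _) := by
          simp only [Matrix.mul_assoc]
      _ = A.det • fromBlocks ((u * v * A.det) • 1) 0 0 (U' * G * V') := by
          rw [h1, h2]
          simp [fromBlocks_multiply, fromBlocks_smul]
      _ = _ := by
          rw [hpoly]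
          simp [fromBlocks_smul, smul_smul]

end AtZero

lemma isCoprime_X_pow_of_eval_ne_zero {F : Type*} [Field F] {w : F[X]} (hw : w.eval 0 ≠ 0)
    (T : ℕ) : IsCoprime ((X : F[X]) ^ T) w := by
  refine IsCoprime.pow_left ((Irreducible.coprime_iff_not_dvd irreducible_X).2 fun h => hw ?_)
  rwa [X_dvd_iff, coeff_zero_eq_eval_zero] at h

/-- Let the pencil `L` be a linearization of the polynomial matrix `P`.
If `rev₁ L` can be written as a linear polynomial system matrix
`[[Ã(λ), B̃(λ)], [-C̃(λ), D̃(λ)]]` whose state matrix `Ã(λ) = Ã₁ λ + Ã₀` is invertible at `0`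
(i.e. `Ã₀ = Ã(0)` is invertible), and the transfer function matrix of `rev₁ L` is equivalent
at `0` to `rev_ℓ P` for some `ℓ ≥ deg P`, then `L` is a strong linearization of `P`. -/
theorem stmt_2 {F : Type*} [Field F] {n p m ℓ : ℕ}
    (L : Matrix (Fin n ⊕ Fin p) (Fin n ⊕ Fin m) (Polynomial F))
    -- `L` is a pencil
    (hLpencil : ∀ i j, (L i j).degree ≤ 1)
    (P : Matrix (Fin p) (Fin m) (Polynomial F))
    -- `L` is a linearization of `P`
    (hlin : ∃ (U₁ : Matrix (Fin p ⊕ Fin n) (Fin n ⊕ Fin p) (Polynomial F))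
        (V₁ : Matrix (Fin n ⊕ Fin m) (Fin m ⊕ Fin n) (Polynomial F)),
        IsUnit ((U₁.submatrix (Equiv.sumComm (Fin n) (Fin p)) id).det) ∧
        IsUnit ((V₁.submatrix (Equiv.sumComm (Fin m) (Fin n)) id).det) ∧
        U₁ * L * V₁ = Matrix.fromBlocks P 0 0 (1 : Matrix (Fin n) (Fin n) (Polynomial F)))
    -- `rev₁ L` (the entrywise degree-1 reversal) written as a polynomial system matrix
    (At : Matrix (Fin n) (Fin n) (Polynomial F))
    (Bt : Matrix (Fin n) (Fin m) (Polynomial F))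
    (Ct : Matrix (Fin p) (Fin n) (Polynomial F))
    (Dt : Matrix (Fin p) (Fin m) (Polynomial F))
    (hblocks : L.map (Polynomial.reflect 1) = Matrix.fromBlocks At Bt (-Ct) Dt)
    -- the state matrix is regular
    (hreg : At.det ≠ 0)
    -- `Ã₀ = Ã(0)` is invertible
    (hA0 : IsUnit (At.map (fun q => Polynomial.eval 0 q)).det)
    -- `ℓ ≥ deg P`
    (hℓ : ∀ i j, (P i j).natDegree ≤ ℓ)
    -- the transfer function matrix of `rev₁ L` is equivalent at `0` to `rev_ℓ P`
    (htf : EquivAtZero (toRat Dt + toRat Ct * (toRat At)⁻¹ * toRat Bt)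
        (toRat (P.map (Polynomial.reflect ℓ)))) :
    -- `L` is a strong linearization of `P`:
    (∃ (U₁ : Matrix (Fin p ⊕ Fin n) (Fin n ⊕ Fin p) (Polynomial F))
        (V₁ : Matrix (Fin n ⊕ Fin m) (Fin m ⊕ Fin n) (Polynomial F)),
        IsUnit ((U₁.submatrix (Equiv.sumComm (Fin n) (Fin p)) id).det) ∧
        IsUnit ((V₁.submatrix (Equiv.sumComm (Fin m) (Fin n)) id).det) ∧
        U₁ * L * V₁ = Matrix.fromBlocks P 0 0 (1 : Matrix (Fin n) (Fin n) (Polynomial F))) ∧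
    (∃ ℓ' : ℕ, (∀ i j, (P i j).natDegree ≤ ℓ') ∧
      ∃ (U₂ : Matrix (Fin p ⊕ Fin n) (Fin n ⊕ Fin p) (Polynomial F))
        (V₂ : Matrix (Fin n ⊕ Fin m) (Fin m ⊕ Fin n) (Polynomial F)),
        IsUnit ((U₂.submatrix (Equiv.sumComm (Fin n) (Fin p)) id).det) ∧
        IsUnit ((V₂.submatrix (Equiv.sumComm (Fin m) (Fin n)) id).det) ∧
        U₂ * (L.map (Polynomial.reflect 1)) * V₂
          = Matrix.fromBlocks (P.map (Polynomial.reflect ℓ')) 0 0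
              (1 : Matrix (Fin n) (Fin n) (Polynomial F))) := by
  refine ⟨hlin, ℓ, hℓ, ?_⟩
  have hdetA : At.det.eval 0 ≠ 0 := by
    rw [← coe_evalRingHom, RingHom.map_det]
    exact hA0.ne_zero
  have hL : ∀ i j, (L i j).natDegree ≤ 1 := fun i j => natDegree_le_of_degree_le (hLpencil i j)
  have hLP : UnimodEquiv L (fromBlocks 1 0 0 P) := by
    obtain ⟨U₁, V₁, hU₁, hV₁, h⟩ := hlin
    refine ⟨U₁.submatrix (Equiv.sumComm (Fin n) (Fin p)) id,
      V₁.submatrix id (Equiv.sumComm (Fin n) (Fin m)), hU₁, ?_, ?_⟩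
    · rw [← det_submatrix_equiv_self (Equiv.sumComm (Fin m) (Fin n)), submatrix_submatrix]
      convert hV₁ using 2
      ext1 i j
      simp
    · rw [← submatrix_id_id L, submatrix_mul _ _ _ id _ Function.bijective_id |>.symm,
        submatrix_mul _ _ _ id _ Function.bijective_id |>.symm, h]
      exact fromBlocks_submatrix_sum_swap_sum_swap _ _ _ _
  obtain ⟨T, hT⟩ := transformsTo_map_reflect hL hℓ hLP
  obtain ⟨T', hT'⟩ := transformsTo_map_reflect_symm hL hℓ hLP
  obtain ⟨U, V, w, hU, hV, hw, h⟩ := exists_mul_systemMatrix_mul hdetA htf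
  rw [← hblocks] at h
  obtain ⟨w', hw', h'⟩ := TransformsTo.symm_of_eval_det_ne_zero h hU hV
  obtain ⟨U₂, V₂, hU₂, hV₂, h₂⟩ :=
    unimodEquiv_of_transformsTo (isCoprime_X_pow_of_eval_ne_zero hw T) hT ⟨U, V, h⟩
      (isCoprime_X_pow_of_eval_ne_zero hw' T') hT' h'
  refine ⟨U₂.submatrix (Equiv.sumComm (Fin p) (Fin n)) id,
    V₂.submatrix id (Equiv.sumComm (Fin m) (Fin n)), ?_, ?_, ?_⟩
  · have hsub : (U₂.submatrix (Equiv.sumComm (Fin p) (Fin n)) id).submatrix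
        (Equiv.sumComm (Fin n) (Fin p)) id = U₂ := by
      ext1 i j
      simp
    rwa [hsub]
  · rw [submatrix_submatrix]
    exact (det_submatrix_equiv_self (Equiv.sumComm (Fin m) (Fin n)) V₂).symm ▸ hV₂
  · rw [← submatrix_id_id (L.map _), submatrix_mul _ _ _ id _ Function.bijective_id |>.symm,
      submatrix_mul _ _ _ id _ Function.bijective_id |>.symm, h₂]
    exact fromBlocks_submatrix_sum_swap_sum_swap _ _ _ _
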